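/- Let f and g be real polynomials, each having degree at most n, each having all roots real and simple, and with max(deg f, deg g) = n. Then the following are equivalent: (1) for every (a,b) ≠ (0,0) in ℝ², the polynomial a·f + b·g again has degree n or n−1 with all roots real and simple; (2) the roots of f and g strictly interlace, i.e., writing the ordered roots of f as s₁ < … and of g as t₁ < … (appending +∞ as a formal largest root for the one of smaller degree), we have either s₁ < t₁ < s₂ < t₂ < … or t₁ < s₁ < t₂ < s₂ < …. -/

import Mathlib

open Polynomial

/-- A real polynomial all of whose roots are real and simple
(it has `natDegree` distinct real roots). -/
def SimpleRealRoots (p : Polynomial ℝ) : Prop :=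
  p ≠ 0 ∧ p.roots.card = p.natDegree ∧ p.roots.Nodup

/-- Membership in `Bₙ`: degree `n` or `n - 1` with all roots real and simple. -/
def MemB (n : ℕ) (p : Polynomial ℝ) : Prop :=
  SimpleRealRoots p ∧ (p.natDegree = n ∨ p.natDegree = n - 1)

/-- Strict interlacing of the roots of `f` and `g`: listing the roots of each in increasing
order inside `EReal`, appending `+∞` as a formal largest root for the polynomial of the
smaller degree `n - 1`, the two ordered `n`-tuples strictly alternate. -/
def StrictlyInterlaced (n : ℕ) (f g : Polynomial ℝ) : Prop :=
  ∃ s t : Fin n → EReal, StrictMono s ∧ StrictMono t ∧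
    (∀ i, s i = ⊤ ∨ ∃ x : ℝ, s i = (x : EReal) ∧ f.IsRoot x) ∧
    (∀ x : ℝ, f.IsRoot x → ∃ i, s i = (x : EReal)) ∧
    (∀ i, t i = ⊤ ∨ ∃ x : ℝ, t i = (x : EReal) ∧ g.IsRoot x) ∧
    (∀ x : ℝ, g.IsRoot x → ∃ i, t i = (x : EReal)) ∧
    (((∀ i, s i < t i) ∧ ∀ i j : Fin n, (j : ℕ) = (i : ℕ) + 1 → t i < s j) ∨
     ((∀ i, t i < s i) ∧ ∀ i j : Fin n, (j : ℕ) = (i : ℕ) + 1 → s i < t j))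

/-- The values of `g` at consecutive points of the increasing sequence `s` have opposite signs. -/
def AlternatesOn {m : ℕ} (g : ℝ[X]) (s : Fin (m + 1) → ℝ) : Prop :=
  (∀ i, g.eval (s i) ≠ 0) ∧ ∀ i : Fin m, g.eval (s i.castSucc) * g.eval (s i.succ) < 0

theorem prod_sub_mul_prod_sub_pos {ι : Type*} (R : Finset ι) (v : ι → ℝ) {x y : ℝ} (hxy : x < y)
    (hv : ∀ k ∈ R, v k < x ∨ y < v k) :
    0 < (∏ k ∈ R, (x - v k)) * ∏ k ∈ R, (y - v k) := by
  rw [← Finset.prod_mul_distrib]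
  refine Finset.prod_pos fun k hk => ?_
  rcases hv k hk with h | h
  · exact mul_pos (by linarith) (by linarith)
  · exact mul_pos_of_neg_of_neg (by linarith) (by linarith)

theorem prod_sub_mul_prod_sub_neg {ι : Type*} [DecidableEq ι] (R : Finset ι) (v : ι → ℝ) {x y : ℝ}
    {k₀ : ι} (hk₀ : k₀ ∈ R) (hx : x < v k₀) (hy : v k₀ < y)
    (hv : ∀ k ∈ R, k ≠ k₀ → v k < x ∨ y < v k) :
    (∏ k ∈ R, (x - v k)) * ∏ k ∈ R, (y - v k) < 0 := by
  have h := prod_sub_mul_prod_sub_pos (R.erase k₀) v (hx.trans hy)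
    (fun k hk => hv k (Finset.mem_of_mem_erase hk) (Finset.ne_of_mem_erase hk))
  rw [← Finset.mul_prod_erase R (fun k => x - v k) hk₀,
    ← Finset.mul_prod_erase R (fun k => y - v k) hk₀]
  have h2 : (x - v k₀) * (y - v k₀) < 0 :=
    mul_neg_of_neg_of_pos (by linarith) (by linarith)
  have := mul_neg_of_neg_of_pos h2 h
  linarith

theorem Fin.exists_castSucc_succ_of_val_eq {m : ℕ} {i j : Fin (m + 1)}
    (h : (j : ℕ) = (i : ℕ) + 1) : ∃ k : Fin m, i = k.castSucc ∧ j = k.succ :=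
  ⟨⟨i, by omega⟩, Fin.ext rfl, Fin.ext h⟩

theorem exists_root_of_eval_mul_neg (p : ℝ[X]) {x y : ℝ} (hxy : x < y)
    (h : p.eval x * p.eval y < 0) : ∃ z, x < z ∧ z < y ∧ p.eval z = 0 := by
  have hc : ContinuousOn (fun z => p.eval z) (Set.Icc x y) := p.continuous.continuousOn
  rcases mul_neg_iff.mp h with ⟨h1, h2⟩ | ⟨h1, h2⟩
  · obtain ⟨z, hz, hz0⟩ := intermediate_value_Ioo' hxy.le hc ⟨h2, h1⟩
    exact ⟨z, hz.1, hz.2, hz0⟩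
  · obtain ⟨z, hz, hz0⟩ := intermediate_value_Ioo hxy.le hc ⟨h1, h2⟩
    exact ⟨z, hz.1, hz.2, hz0⟩

/-- A strictly increasing sequence of points separated by the points `s` is strictly
increasing. -/
theorem strictMono_of_separated {m : ℕ} {s : Fin (m + 1) → ℝ} (hs : StrictMono s) {u : Fin m → ℝ}
    (hu : ∀ i, s i.castSucc < u i ∧ u i < s i.succ) : StrictMono u := by
  intro i j hij
  have h : s i.succ ≤ s j.castSucc := hs.monotone (by
    rw [Fin.le_def, Fin.val_succ, Fin.val_castSucc]; exact hij)
  linarith [(hu i).2, (hu j).1]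

theorem AlternatesOn.roots {m : ℕ} {p : ℝ[X]} (hdeg : p.natDegree ≤ m + 1)
    {s : Fin (m + 1) → ℝ} (hs : StrictMono s) (h : AlternatesOn p s) :
    ∃ u : Fin m → ℝ, (∀ i, s i.castSucc < u i ∧ u i < s i.succ) ∧
      ((p.natDegree = m ∧ p.roots = Finset.univ.val.map u) ∨
        ∃ r, p.natDegree = m + 1 ∧ p.roots = r ::ₘ Finset.univ.val.map u ∧
          (r < s 0 ∨ s (Fin.last m) < r)) := by
  have hp : p ≠ 0 := by
    rintro rfl
    exact h.1 0 (by simp)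
  choose u hu1 hu2 hu0 using fun i : Fin m =>
    exists_root_of_eval_mul_neg p (hs (Fin.castSucc_lt_succ (i := i))) (h.2 i)
  have hu : ∀ i, s i.castSucc < u i ∧ u i < s i.succ := fun i => ⟨hu1 i, hu2 i⟩
  have hmono := strictMono_of_separated hs hu
  refine ⟨u, hu, ?_⟩
  have hle : Finset.univ.val.map u ≤ p.roots := by
    rw [Multiset.le_iff_subset (Finset.univ.nodup.map hmono.injective)]
    intro x hx
    obtain ⟨i, -, rfl⟩ := Multiset.mem_map.mp hx
    exact (mem_roots hp).mpr (hu0 i)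
  obtain ⟨q, hq⟩ := (Multiset.prod_X_sub_C_dvd_iff_le_roots hp _).mpr hle
  set N : ℝ[X] := (Multiset.map (fun a => X - C a) (Finset.univ.val.map u)).prod with hN
  have hN0 : N ≠ 0 := left_ne_zero_of_mul (hq ▸ hp)
  have hq0 : q ≠ 0 := right_ne_zero_of_mul (hq ▸ hp)
  have hNroots : N.roots = Finset.univ.val.map u := roots_multiset_prod_X_sub_C _
  have hNdeg : N.natDegree = m := by
    rw [hN, natDegree_multiset_prod_X_sub_C_eq_card]; simp
  have hpdeg : p.natDegree = m + q.natDegree := by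
    rw [hq, natDegree_mul hN0 hq0, hNdeg]
  have hproots : p.roots = q.roots + Finset.univ.val.map u := by
    rw [hq, roots_mul (mul_ne_zero hN0 hq0), hNroots, add_comm]
  have hNeval : ∀ x, N.eval x = ∏ i, (x - u i) := by
    intro x
    rw [hN, Multiset.map_map]
    change (∏ i, (X - C (u i))).eval x = _
    simp [eval_prod]
  have hqpos : ∀ i : Fin m, 0 < q.eval (s i.castSucc) * q.eval (s i.succ) := by
    intro i
    have h1 := h.2 i
    rw [hq, eval_mul, eval_mul, hNeval, hNeval] at h1
    have h2 := prod_sub_mul_prod_sub_neg Finset.univ u (Finset.mem_univ i) (hu1 i) (hu2 i)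
      (fun k _ hk => by
        rcases lt_or_gt_of_ne hk with hk | hk
        · left
          exact (hu2 k).trans_le (hs.monotone (by
            rw [Fin.le_def, Fin.val_succ, Fin.val_castSucc]; exact hk))
        · right
          exact lt_of_le_of_lt (hs.monotone (by
            rw [Fin.le_def, Fin.val_succ, Fin.val_castSucc]; exact hk)) (hu1 k))
    by_contra hcon
    nlinarith [mul_nonneg_of_nonpos_of_nonpos h2.le (not_lt.mp hcon)]
  rcases Nat.lt_or_ge q.natDegree 1 with hd | hd
  · left
    have hqd : q.natDegree = 0 := by omega
    refine ⟨by omega, ?_⟩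
    rw [eq_C_of_natDegree_eq_zero hqd] at hproots
    simpa using hproots
  · right
    have hqd : q.natDegree = 1 := by omega
    obtain ⟨a, ha, b, hab⟩ := natDegree_eq_one.mp hqd
    have hqr : q.roots = {-(a⁻¹ * b)} := by
      rw [← hab, roots_C_mul_X_add_C b ha]
    have hqe : ∀ x, q.eval x = a * (x - -(a⁻¹ * b)) := by
      intro x
      rw [← hab]
      simp only [eval_add, eval_mul, eval_C, eval_X]
      field_simp
      ring
    generalize -(a⁻¹ * b) = r at hqr hqe
    refine ⟨r, by omega, by rw [hproots, hqr, Multiset.singleton_add], ?_⟩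
    rcases lt_or_ge r (s 0) with hr | hr
    · exact Or.inl hr
    right
    have hne : ∀ i, s i ≠ r := by
      intro i hi
      apply h.1 i
      rw [hq, eval_mul, hqe, hi]
      simp
    have key : ∀ i, s i < r := by
      intro i
      induction i using Fin.induction with
      | zero => exact lt_of_le_of_ne hr (hne 0)
      | succ i ih =>
        have h1 := hqpos i
        rw [hqe, hqe] at h1
        by_contra hcon
        have h3 : (s i.castSucc - r) * (s i.succ - r) ≤ 0 :=
          mul_nonpos_of_nonpos_of_nonneg (by linarith) (by linarith)
        nlinarith [mul_nonneg (mul_self_nonneg a) (neg_nonneg.mpr h3)]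
    exact key _

theorem AlternatesOn.memB {m : ℕ} {p : ℝ[X]} (hdeg : p.natDegree ≤ m + 1)
    {s : Fin (m + 1) → ℝ} (hs : StrictMono s) (h : AlternatesOn p s) : MemB (m + 1) p := by
  have hp : p ≠ 0 := by
    rintro rfl
    exact h.1 0 (by simp)
  obtain ⟨u, hu, ⟨hd, hr⟩ | ⟨r, hd, hr, hor⟩⟩ := h.roots hdeg hs
  · refine ⟨⟨hp, ?_, ?_⟩, Or.inr (by simpa using hd)⟩
    · rw [hr, hd]; simp
    · rw [hr]
      exact Finset.univ.nodup.map (strictMono_of_separated hs hu).injective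
  · refine ⟨⟨hp, ?_, ?_⟩, Or.inl hd⟩
    · rw [hr, hd]; simp
    · rw [hr, Multiset.nodup_cons]
      refine ⟨fun hmem => ?_, Finset.univ.nodup.map (strictMono_of_separated hs hu).injective⟩
      obtain ⟨i, -, rfl⟩ := Multiset.mem_map.mp hmem
      have h1 := hs.monotone (Fin.zero_le i.castSucc)
      have h2 := hs.monotone (Fin.le_last i.succ)
      rcases hor with hor | hor
      · linarith [(hu i).1]
      · linarith [(hu i).2]

theorem MemB.smul {n : ℕ} {f : ℝ[X]} (hf : MemB n f) {a : ℝ} (ha : a ≠ 0) : MemB n (a • f) := by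
  obtain ⟨⟨h0, hc, hn⟩, hd⟩ := hf
  have hdeg : (a • f).natDegree = f.natDegree := natDegree_smul f ha
  refine ⟨⟨smul_ne_zero ha h0, ?_, ?_⟩, ?_⟩
  · rw [roots_smul_nonzero f ha, hdeg, hc]
  · rwa [roots_smul_nonzero f ha]
  · rwa [hdeg]

theorem AlternatesOn.memB_pencil {m : ℕ} {f g : ℝ[X]} (hf : MemB (m + 1) f)
    (hfd : f.natDegree ≤ m + 1) (hgd : g.natDegree ≤ m + 1) {s : Fin (m + 1) → ℝ}
    (hs : StrictMono s) (hfs : ∀ i, f.eval (s i) = 0) (h : AlternatesOn g s)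
    {a b : ℝ} (hab : (a, b) ≠ (0, 0)) : MemB (m + 1) (a • f + b • g) := by
  by_cases hb : b = 0
  · subst hb
    have ha : a ≠ 0 := fun ha => hab (by rw [ha])
    simpa using hf.smul ha
  refine AlternatesOn.memB ?_ hs ⟨fun i => ?_, fun i => ?_⟩
  · exact natDegree_add_le_of_degree_le ((natDegree_smul_le _ _).trans hfd)
      ((natDegree_smul_le _ _).trans hgd)
  · simpa [hfs] using ⟨hb, h.1 i⟩
  · simp only [eval_add, eval_smul, hfs, smul_eq_mul, mul_zero, zero_add]
    nlinarith [h.2 i, mul_pos_of_neg_of_neg (neg_neg_of_pos (sq_pos_of_ne_zero hb)) (h.2 i)]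

theorem SimpleRealRoots.derivative_eval_ne_zero {p : ℝ[X]} (hp : SimpleRealRoots p) {x : ℝ}
    (hx : p.eval x = 0) : (derivative p).eval x ≠ 0 := by
  intro h
  have h1 : 1 < p.rootMultiplicity x :=
    (one_lt_rootMultiplicity_iff_isRoot hp.1).mpr ⟨hx, h⟩
  have h2 := Multiset.nodup_iff_count_le_one.mp hp.2.2 x
  rw [count_roots] at h2
  omega

theorem wronskian_eval_ne_zero {n : ℕ} {f g : ℝ[X]}
    (h : ∀ a b : ℝ, (a, b) ≠ (0, 0) → MemB n (a • f + b • g)) (hf : SimpleRealRoots f) (x : ℝ) :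
    (wronskian f g).eval x ≠ 0 := by
  intro hW
  simp only [wronskian, eval_sub, eval_mul] at hW
  by_cases h0 : f.eval x = 0
  · have h1 := hf.derivative_eval_ne_zero h0
    refine (h (-(derivative g).eval x) ((derivative f).eval x)
      (by simp [h1])).1.derivative_eval_ne_zero (x := x) ?_ ?_
    · simp only [eval_add, eval_smul, smul_eq_mul]
      linarith
    · simp only [derivative_add, derivative_smul, eval_add, eval_smul, smul_eq_mul]
      ring
  · refine (h (-g.eval x) (f.eval x) (by simp [h0])).1.derivative_eval_ne_zero (x := x) ?_ ?_
    · simp only [eval_add, eval_smul, smul_eq_mul]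
      ring
    · simp only [derivative_add, derivative_smul, eval_add, eval_smul, smul_eq_mul]
      linarith

theorem SimpleRealRoots.exists_strictMono_roots {f : ℝ[X]} (hf : SimpleRealRoots f) {n : ℕ}
    (hd : f.natDegree = n) : ∃ s : Fin n → ℝ, StrictMono s ∧ ∀ x, f.IsRoot x ↔ ∃ i, s i = x := by
  have hc : f.roots.toFinset.card = n := by
    rw [Multiset.toFinset_card_of_nodup hf.2.2, hf.2.1, hd]
  refine ⟨f.roots.toFinset.orderEmbOfFin hc, OrderEmbedding.strictMono _, fun x => ?_⟩
  have := Finset.range_orderEmbOfFin f.roots.toFinset hc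
  rw [← Set.mem_range, this]
  simp [hf.1]

theorem SimpleRealRoots.eq_C_mul_prod {f : ℝ[X]} (hf : SimpleRealRoots f) :
    f = C f.leadingCoeff * ∏ x ∈ f.roots.toFinset, (X - C x) := by
  conv_lhs => rw [← C_leadingCoeff_mul_prod_multiset_X_sub_C hf.2.1]
  congr 1
  rw [Finset.prod_eq_multiset_prod, Multiset.toFinset_val, hf.2.2.dedup]

theorem SimpleRealRoots.derivative_eval_mul_neg {f : ℝ[X]} (hf : SimpleRealRoots f) {x y : ℝ}
    (hxy : x < y) (hx : f.IsRoot x) (hy : f.IsRoot y)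
    (hgap : ∀ z, f.IsRoot z → z ≤ x ∨ y ≤ z) :
    (derivative f).eval x * (derivative f).eval y < 0 := by
  have hmem : ∀ z, z ∈ f.roots.toFinset ↔ f.IsRoot z := by simp [hf.1]
  have hfe := hf.eq_C_mul_prod
  set c := f.leadingCoeff with hc
  have hc0 : c ≠ 0 := leadingCoeff_ne_zero.mpr hf.1
  set R := f.roots.toFinset
  have hder : ∀ z ∈ R, (derivative f).eval z = c * ∏ k ∈ R.erase z, (z - k) := by
    intro z hz
    have := Lagrange.eval_nodal_derivative_eval_node_eq (v := fun t : ℝ => t) hz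
    rw [Lagrange.eval_nodal] at this
    rw [hfe, derivative_C_mul, eval_mul, eval_C, ← this]
    rfl
  have hxR := (hmem x).mpr hx
  have hyR := (hmem y).mpr hy
  rw [hder x hxR, hder y hyR]
  rw [← Finset.mul_prod_erase (R.erase x) _ (Finset.mem_erase.mpr ⟨hxy.ne', hyR⟩),
    ← Finset.mul_prod_erase (R.erase y) _ (Finset.mem_erase.mpr ⟨hxy.ne, hxR⟩),
    Finset.erase_right_comm (a := y) (b := x)]
  have h := prod_sub_mul_prod_sub_pos ((R.erase x).erase y) (fun t => t) hxy (fun k hk => by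
    simp only [Finset.mem_erase] at hk
    rcases hgap k ((hmem k).mp hk.2.2) with h | h
    · exact Or.inl (lt_of_le_of_ne h hk.2.1)
    · exact Or.inr (lt_of_le_of_ne h (Ne.symm hk.1)))
  have h2 : 0 < (c * (y - x)) ^ 2 := by
    have := mul_ne_zero hc0 (sub_ne_zero.mpr hxy.ne')
    positivity
  nlinarith [mul_pos h2 h]

theorem alternatesOn_of_pencil {m : ℕ} {f g : ℝ[X]} (hf : SimpleRealRoots f)
    (h : ∀ a b : ℝ, (a, b) ≠ (0, 0) → MemB (m + 1) (a • f + b • g))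
    {s : Fin (m + 1) → ℝ} (hs : StrictMono s) (hfs : ∀ x, f.IsRoot x ↔ ∃ i, s i = x) :
    AlternatesOn g s := by
  have hW := wronskian_eval_ne_zero h hf
  have hroot : ∀ i, f.eval (s i) = 0 := fun i => (hfs _).mpr ⟨i, rfl⟩
  have hWs : ∀ i, (wronskian f g).eval (s i) = -((derivative f).eval (s i) * g.eval (s i)) := by
    intro i
    simp [wronskian, hroot i]
  refine ⟨fun i hi => hW (s i) (by rw [hWs, hi]; simp), fun i => ?_⟩
  have hlt := hs (Fin.castSucc_lt_succ (i := i))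
  have h1 : 0 ≤ (wronskian f g).eval (s i.castSucc) * (wronskian f g).eval (s i.succ) := by
    by_contra hcon
    obtain ⟨z, -, -, hz⟩ := exists_root_of_eval_mul_neg _ hlt (not_le.mp hcon)
    exact hW z hz
  have h2 := lt_of_le_of_ne h1 (Ne.symm (mul_ne_zero (hW _) (hW _)))
  rw [hWs, hWs] at h2
  have h3 := hf.derivative_eval_mul_neg hlt (hroot _) (hroot _) (fun z hz => by
    obtain ⟨k, rfl⟩ := (hfs z).mp hz
    rcases Nat.lt_or_ge i.val k.val with hk | hk
    · exact Or.inr (hs.monotone (by rw [Fin.le_def, Fin.val_succ]; exact hk))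
    · exact Or.inl (hs.monotone (by rw [Fin.le_def, Fin.val_castSucc]; exact hk)))
  by_contra hcon
  nlinarith [mul_nonneg (neg_nonneg.mpr h3.le) (not_lt.mp hcon)]

theorem AlternatesOn.strictlyInterlaced {m : ℕ} {f g : ℝ[X]} (hgd : g.natDegree ≤ m + 1)
    {s : Fin (m + 1) → ℝ} (hs : StrictMono s) (hfs : ∀ x, f.IsRoot x ↔ ∃ i, s i = x)
    (h : AlternatesOn g s) : StrictlyInterlaced (m + 1) f g := by
  have hg : g ≠ 0 := by
    rintro rfl
    exact h.1 0 (by simp)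
  have hsE : StrictMono fun i => (s i : EReal) := fun i j hij => EReal.coe_lt_coe (hs hij)
  have hs1 : ∀ i, (s i : EReal) = ⊤ ∨ ∃ x : ℝ, (s i : EReal) = (x : EReal) ∧ f.IsRoot x :=
    fun i => Or.inr ⟨s i, rfl, (hfs _).mpr ⟨i, rfl⟩⟩
  have hs2 : ∀ x : ℝ, f.IsRoot x → ∃ i, (s i : EReal) = (x : EReal) := fun x hx => by
    obtain ⟨i, hi⟩ := (hfs x).mp hx
    exact ⟨i, by rw [hi]⟩
  obtain ⟨u, hu, hcase⟩ := h.roots hgd hs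
  have huroot : ∀ i, g.IsRoot (u i) := by
    intro i
    have hmem : u i ∈ Finset.univ.val.map u := Multiset.mem_map.mpr ⟨i, Finset.mem_univ i, rfl⟩
    refine (mem_roots hg).mp ?_
    rcases hcase with ⟨-, hr⟩ | ⟨r, -, hr, -⟩
    · rwa [hr]
    · rw [hr]
      exact Multiset.mem_cons_of_mem hmem
  have hright : ∀ T : EReal, (s (Fin.last m) : EReal) < T →
      (T = ⊤ ∨ ∃ x : ℝ, T = (x : EReal) ∧ g.IsRoot x) →
      (∀ x : ℝ, g.IsRoot x → T = x ∨ ∃ i, u i = x) → StrictlyInterlaced (m + 1) f g := by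
    intro T hT hT1 hT2
    have h1 : ∀ i, (s i : EReal) < Fin.snoc (α := fun _ => EReal) (fun i => (u i : EReal)) T i := by
      intro i
      induction i using Fin.lastCases with
      | last => simpa using hT
      | cast i => simpa using (hu i).1
    have h2 : ∀ k : Fin m,
        Fin.snoc (α := fun _ => EReal) (fun i => (u i : EReal)) T k.castSucc < (s k.succ : EReal) := by
      intro k
      simpa using (hu k).2
    refine ⟨fun i => s i, Fin.snoc (fun i => (u i : EReal)) T, hsE, ?_, hs1, hs2, ?_, ?_,
      Or.inl ⟨h1, ?_⟩⟩
    · exact Fin.strictMono_iff_lt_succ.mpr fun k => (h2 k).trans (h1 k.succ)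
    · intro i
      induction i using Fin.lastCases with
      | last => simpa using hT1
      | cast i => exact Or.inr ⟨u i, by simp, huroot i⟩
    · intro x hx
      rcases hT2 x hx with rfl | ⟨i, rfl⟩
      · exact ⟨Fin.last m, by simp⟩
      · exact ⟨i.castSucc, by simp⟩
    · intro i j hij
      obtain ⟨k, rfl, rfl⟩ := Fin.exists_castSucc_succ_of_val_eq hij
      exact h2 k
  rcases hcase with ⟨-, hr⟩ | ⟨r, -, hr, hlt | hgt⟩
  · refine hright ⊤ (EReal.coe_lt_top _) (Or.inl rfl) fun x hx => Or.inr ?_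
    rw [← mem_roots hg, hr, Multiset.mem_map] at hx
    obtain ⟨i, -, hi⟩ := hx
    exact ⟨i, hi⟩
  · have hrroot : g.IsRoot r := (mem_roots hg).mp (by rw [hr]; exact Multiset.mem_cons_self _ _)
    have h1 : ∀ i, Fin.cons (α := fun _ => EReal) (r : EReal) (fun i => (u i : EReal)) i
        < (s i : EReal) := by
      intro i
      induction i using Fin.cases with
      | zero => simpa using hlt
      | succ i => simpa using (hu i).2
    have h2 : ∀ k : Fin m, (s k.castSucc : EReal) <
        Fin.cons (α := fun _ => EReal) (r : EReal) (fun i => (u i : EReal)) k.succ := by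
      intro k
      simpa using (hu k).1
    refine ⟨fun i => s i, Fin.cons (r : EReal) (fun i => (u i : EReal)), hsE, ?_, hs1, hs2, ?_, ?_,
      Or.inr ⟨h1, ?_⟩⟩
    · exact Fin.strictMono_iff_lt_succ.mpr fun k => (h1 k.castSucc).trans (h2 k)
    · intro i
      right
      induction i using Fin.cases with
      | zero => exact ⟨r, by simp, hrroot⟩
      | succ i => exact ⟨u i, by simp, huroot i⟩
    · intro x hx
      rw [← mem_roots hg, hr, Multiset.mem_cons, Multiset.mem_map] at hx
      rcases hx with rfl | ⟨i, -, rfl⟩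
      · exact ⟨0, by simp⟩
      · exact ⟨i.succ, by simp⟩
    · intro i j hij
      obtain ⟨k, rfl, rfl⟩ := Fin.exists_castSucc_succ_of_val_eq hij
      exact h2 k
  · have hrroot : g.IsRoot r := (mem_roots hg).mp (by rw [hr]; exact Multiset.mem_cons_self _ _)
    refine hright r (EReal.coe_lt_coe hgt) (Or.inr ⟨r, rfl, hrroot⟩) fun x hx => ?_
    rw [← mem_roots hg, hr, Multiset.mem_cons, Multiset.mem_map] at hx
    rcases hx with rfl | ⟨i, -, hi⟩
    · exact Or.inl rfl
    · exact Or.inr ⟨i, hi⟩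

theorem SimpleRealRoots.eval_mul_neg {g : ℝ[X]} (hg : SimpleRealRoots g) {x y z : ℝ}
    (hz : g.IsRoot z) (hxz : x < z) (hzy : z < y)
    (hgap : ∀ w, g.IsRoot w → w ≠ z → w < x ∨ y < w) : g.eval x * g.eval y < 0 := by
  have h := prod_sub_mul_prod_sub_neg g.roots.toFinset (fun t => t) (x := x) (y := y) (k₀ := z)
    (by simpa [hg.1] using hz) hxz hzy
    (fun w hw hwz => hgap w (by simpa [hg.1] using hw) hwz)
  have hc : 0 < g.leadingCoeff ^ 2 := by
    have := leadingCoeff_ne_zero.mpr hg.1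
    positivity
  have he : ∀ w, g.eval w = g.leadingCoeff * ∏ k ∈ g.roots.toFinset, (w - k) := by
    intro w
    conv_lhs => rw [hg.eq_C_mul_prod]
    simp [eval_prod]
  rw [he, he]
  nlinarith [mul_pos hc (neg_pos.mpr h)]

theorem StrictlyInterlaced.exists_alternatesOn {m : ℕ} {f g : ℝ[X]} (hf : SimpleRealRoots f)
    (hfd : f.natDegree = m + 1) (hg : SimpleRealRoots g) (h : StrictlyInterlaced (m + 1) f g) :
    ∃ s : Fin (m + 1) → ℝ, StrictMono s ∧ (∀ i, f.eval (s i) = 0) ∧ AlternatesOn g s := by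
  obtain ⟨s, t, hs, ht, hs1, hs2, ht1, ht2, hst⟩ := h
  obtain ⟨σ, hσ, hσf⟩ := hf.exists_strictMono_roots hfd
  choose φ hφ using fun k => hs2 (σ k) ((hσf _).mpr ⟨k, rfl⟩)
  have hφinj : Function.Injective φ := fun a b hab => hσ.injective (by
    rw [← EReal.coe_eq_coe_iff, ← hφ, ← hφ, hab])
  have hsreal : ∀ i, ∃ x : ℝ, s i = x ∧ f.eval x = 0 := by
    intro i
    obtain ⟨k, rfl⟩ := Finite.surjective_of_injective hφinj i
    exact ⟨σ k, hφ k, (hσf _).mpr ⟨k, rfl⟩⟩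
  choose ρ hρ hρf using hsreal
  have hρmono : StrictMono ρ := fun i j hij => by
    have := hs hij
    rwa [hρ, hρ, EReal.coe_lt_coe_iff] at this
  refine ⟨ρ, hρmono, hρf, ?_⟩
  have htroot : ∀ j (T : EReal), t j < T → ∃ x : ℝ, t j = x ∧ g.IsRoot x := fun j T hT =>
    (ht1 j).resolve_left hT.ne_top
  rcases hst with ⟨ha, hb⟩ | ⟨ha, hb⟩
  · have hlow : ∀ i j, i ≤ j → s i < t j := fun i j hij => (ha i).trans_le (ht.monotone hij)
    have hhigh : ∀ i j : Fin (m + 1), j < i → t j < s i := fun i j hij => by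
      have hlt : j.val + 1 < m + 1 := lt_of_le_of_lt hij i.isLt
      exact (hb j ⟨j.val + 1, hlt⟩ rfl).trans_le (hs.monotone hij)
    refine ⟨fun i hi => ?_, fun k => ?_⟩
    · obtain ⟨j, hj⟩ := ht2 _ hi
      rw [← hρ] at hj
      rcases le_or_gt i j with hij | hij
      · exact (hlow i j hij).ne' hj
      · exact (hhigh i j hij).ne hj
    · have h1 := hlow k.castSucc k.castSucc le_rfl
      have h2 := hhigh k.succ k.castSucc Fin.castSucc_lt_succ
      obtain ⟨z, hz, hzr⟩ := htroot _ _ h2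
      rw [hz, hρ, EReal.coe_lt_coe_iff] at h1 h2
      refine hg.eval_mul_neg hzr h1 h2 fun w hw hwz => ?_
      obtain ⟨j, hj⟩ := ht2 w hw
      rcases lt_trichotomy j k.castSucc with hjk | rfl | hjk
      · have := hhigh _ _ hjk
        rw [hj, hρ, EReal.coe_lt_coe_iff] at this
        exact Or.inl this
      · rw [hz, EReal.coe_eq_coe_iff] at hj
        exact absurd hj.symm hwz
      · have := hlow k.succ j (Fin.castSucc_lt_iff_succ_le.mp hjk)
        rw [hj, hρ, EReal.coe_lt_coe_iff] at this
        exact Or.inr this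
  · have hlow : ∀ i j, j ≤ i → t j < s i := fun i j hij => (ht.monotone hij).trans_lt (ha i)
    have hhigh : ∀ i j : Fin (m + 1), i < j → s i < t j := fun i j hij => by
      have hlt : i.val + 1 < m + 1 := lt_of_le_of_lt hij j.isLt
      exact (hb i ⟨i.val + 1, hlt⟩ rfl).trans_le (ht.monotone hij)
    refine ⟨fun i hi => ?_, fun k => ?_⟩
    · obtain ⟨j, hj⟩ := ht2 _ hi
      rw [← hρ] at hj
      rcases le_or_gt j i with hij | hij
      · exact (hlow i j hij).ne hj
      · exact (hhigh i j hij).ne' hj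
    · have h1 := hhigh k.castSucc k.succ Fin.castSucc_lt_succ
      have h2 := hlow k.succ k.succ le_rfl
      obtain ⟨z, hz, hzr⟩ := htroot _ _ h2
      rw [hz, hρ, EReal.coe_lt_coe_iff] at h1 h2
      refine hg.eval_mul_neg hzr h1 h2 fun w hw hwz => ?_
      obtain ⟨j, hj⟩ := ht2 w hw
      rcases lt_trichotomy j k.succ with hjk | rfl | hjk
      · have := hlow k.castSucc j (Fin.le_castSucc_iff.mpr hjk)
        rw [hj, hρ, EReal.coe_lt_coe_iff] at this
        exact Or.inl this
      · rw [hz, EReal.coe_eq_coe_iff] at hj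
        exact absurd hj.symm hwz
      · have := hhigh _ _ hjk
        rw [hj, hρ, EReal.coe_lt_coe_iff] at this
        exact Or.inr this

theorem StrictlyInterlaced.symm {n : ℕ} {f g : ℝ[X]} (h : StrictlyInterlaced n f g) :
    StrictlyInterlaced n g f := by
  obtain ⟨s, t, hs, ht, hs1, hs2, ht1, ht2, hst⟩ := h
  exact ⟨t, s, ht, hs, ht1, ht2, hs1, hs2, hst.symm⟩

theorem memB_pencil_iff_strictlyInterlaced {m : ℕ} {f g : ℝ[X]} (hf : MemB (m + 1) f)
    (hg : MemB (m + 1) g) (hfd : f.natDegree = m + 1) :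
    (∀ a b : ℝ, (a, b) ≠ (0, 0) → MemB (m + 1) (a • f + b • g)) ↔
      StrictlyInterlaced (m + 1) f g := by
  have hgd : g.natDegree ≤ m + 1 := by
    rcases hg.2 with h | h <;> omega
  constructor
  · intro h
    obtain ⟨s, hs, hfs⟩ := hf.1.exists_strictMono_roots hfd
    exact (alternatesOn_of_pencil hf.1 h hs hfs).strictlyInterlaced hgd hs hfs
  · intro h a b hab
    obtain ⟨s, hs, hfs, halt⟩ := h.exists_alternatesOn hf.1 hfd hg.1
    exact halt.memB_pencil hf hfd.le hgd hs hfs hab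

theorem stmt0 (n : ℕ) (hn : 0 < n) (f g : Polynomial ℝ)
    (hf : MemB n f) (hg : MemB n g)
    (hmax : max f.natDegree g.natDegree = n) :
    (∀ a b : ℝ, (a, b) ≠ (0, 0) → MemB n (a • f + b • g)) ↔
      StrictlyInterlaced n f g := by
  obtain ⟨m, rfl⟩ : ∃ m, n = m + 1 := ⟨n - 1, by omega⟩
  rcases max_choice f.natDegree g.natDegree with h | h
  · exact memB_pencil_iff_strictlyInterlaced hf hg (h.symm.trans hmax)
  · have key := memB_pencil_iff_strictlyInterlaced hg hf (h.symm.trans hmax)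
    refine ⟨fun H => (key.mp fun a b hab => ?_).symm, fun H a b hab => ?_⟩
    · rw [add_comm (a • g)]
      exact H b a (by simpa [and_comm] using hab)
    · rw [add_comm (a • f)]
      exact key.mpr H.symm b a (by simpa [and_comm] using hab)
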